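/- arXiv:2007.08717 — 3 statements merged into one kernel-verified Lean document; each statement's English description precedes it below -/
import Mathlib

section
/- Let P be a set of n points in the plane ℝ² and let q ∈ ℝ² be a point with q ∉ P such that P ∪ {q} is in general position (no three of its points are collinear). Let k be the Tukey depth of q with respect to P. Then there exist τ = min(⌊n/3⌋, k) pairwise disjoint subsets of P, each of size 3, such that the convex hull of each subset contains q. -/
open scoped RealInnerProductSpace

/-- The Tukey depth of a point `q` with respect to a set `P ⊆ ℝ^d`: the minimum number of
points of `P` contained in a closed halfspace containing `q`. -/
noncomputable def tukeyDepth {d : ℕ} (P : Set (EuclideanSpace ℝ (Fin d)))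
    (q : EuclideanSpace ℝ (Fin d)) : ℕ :=
  sInf { m : ℕ | ∃ (v : EuclideanSpace ℝ (Fin d)) (c : ℝ),
    v ≠ 0 ∧ ⟪v, q⟫ ≤ c ∧ (P ∩ {x | ⟪v, x⟫ ≤ c}).ncard = m }

/-- Every closed halfplane with `q` on its boundary contains at least `m` points of `S`. -/
def HasDepthAtLeast (S : Finset (EuclideanSpace ℝ (Fin 2))) (q : EuclideanSpace ℝ (Fin 2))
    (m : ℕ) : Prop :=
  ∀ v : EuclideanSpace ℝ (Fin 2), v ≠ 0 → m ≤ (S.filter fun p => ⟪v, p - q⟫ ≤ 0).card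

lemma hasDepthAtLeast_tukeyDepth (S : Finset (EuclideanSpace ℝ (Fin 2)))
    (q : EuclideanSpace ℝ (Fin 2)) :
    HasDepthAtLeast S q (tukeyDepth (S : Set (EuclideanSpace ℝ (Fin 2))) q) := by
  intro v hv
  refine Nat.sInf_le ⟨v, ⟪v, q⟫, hv, le_rfl, ?_⟩
  rw [← Set.ncard_coe_finset]
  congr 1
  ext x
  simp [inner_sub_right]

/-- Among four vectors of the plane there is no way to realize, for each of them, a point on
whose nonpositive side lies only that vector. -/
lemma false_of_four_private_points (v p : Fin 4 → EuclideanSpace ℝ (Fin 2))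
    (hself : ∀ i, ⟪v i, p i⟫ ≤ 0) (hother : ∀ i j, j ≠ i → 0 < ⟪v j, p i⟫) : False := by
  have hdep : ¬ LinearIndependent ℝ ![v 0, v 1, v 2] := by
    intro h
    have := h.fintype_card_le_finrank
    simp at this
  obtain ⟨c, hc, i, hi⟩ := Fintype.not_linearIndependent_iff.1 hdep
  have hsum : ∀ j, c 0 * ⟪v 0, p j⟫ + c 1 * ⟪v 1, p j⟫ + c 2 * ⟪v 2, p j⟫ = 0 := by
    intro j
    have := congrArg (fun x => ⟪x, p j⟫) hc
    simpa [Fin.sum_univ_three, inner_add_left, real_inner_smul_left] using this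
  have key : ∀ a b d x y z : ℝ, a * x + b * y + d * z = 0 → 0 < a → b ≤ 0 → d ≤ 0 →
      (b < 0 ∨ d < 0) → x ≤ 0 → 0 < y → 0 < z → False := by
    intro a b d x y z h ha hb hd hbd hx hy hz
    have h1 := mul_nonpos_of_nonneg_of_nonpos ha.le hx
    have h2 := mul_nonpos_of_nonpos_of_nonneg hb hy.le
    have h3 := mul_nonpos_of_nonpos_of_nonneg hd hz.le
    rcases hbd with hb | hd
    · nlinarith [mul_neg_of_neg_of_pos hb hy]
    · nlinarith [mul_neg_of_neg_of_pos hd hz]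
  have pos : ∀ a b d x y z : ℝ, a * x + b * y + d * z = 0 → 0 ≤ a → 0 ≤ b → 0 ≤ d →
      0 < x → 0 < y → 0 < z → a = 0 ∧ b = 0 ∧ d = 0 := by
    intro a b d x y z h ha hb hd hx hy hz
    have h1 := mul_nonneg ha hx.le
    have h2 := mul_nonneg hb hy.le
    have h3 := mul_nonneg hd hz.le
    refine ⟨?_, ?_, ?_⟩
    · exact (mul_eq_zero.1 (by linarith : a * x = 0)).resolve_right hx.ne'
    · exact (mul_eq_zero.1 (by linarith : b * y = 0)).resolve_right hy.ne'
    · exact (mul_eq_zero.1 (by linarith : d * z = 0)).resolve_right hz.ne'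
  have hne : ¬ (c 0 = 0 ∧ c 1 = 0 ∧ c 2 = 0) := by
    rintro ⟨h0, h1, h2⟩
    fin_cases i
    exacts [hi h0, hi h1, hi h2]
  have q0 := hother 3 0 (by decide)
  have q1 := hother 3 1 (by decide)
  have q2 := hother 3 2 (by decide)
  have a01 := hother 0 1 (by decide)
  have a02 := hother 0 2 (by decide)
  have a10 := hother 1 0 (by decide)
  have a12 := hother 1 2 (by decide)
  have a20 := hother 2 0 (by decide)
  have a21 := hother 2 1 (by decide)
  have s0 := hsum 0
  have s1 := hsum 1
  have s2 := hsum 2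
  have hpos : ¬ (0 ≤ c 0 ∧ 0 ≤ c 1 ∧ 0 ≤ c 2) := fun ⟨h0, h1, h2⟩ =>
    hne (pos _ _ _ _ _ _ (hsum 3) h0 h1 h2 q0 q1 q2)
  have hneg : ¬ (c 0 ≤ 0 ∧ c 1 ≤ 0 ∧ c 2 ≤ 0) := fun ⟨h0, h1, h2⟩ => by
    have := pos (-c 0) (-c 1) (-c 2) _ _ _ (by linarith [hsum 3]) (by linarith) (by linarith)
      (by linarith) q0 q1 q2
    exact hne ⟨by linarith [this.1], by linarith [this.2.1], by linarith [this.2.2]⟩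
  have solve : ∀ a b d x y z : ℝ, a * x + b * y + d * z = 0 → x ≤ 0 → 0 < y → 0 < z →
      ¬ (0 < a ∧ b ≤ 0 ∧ d ≤ 0 ∧ (b < 0 ∨ d < 0)) ∧
      ¬ (a < 0 ∧ 0 ≤ b ∧ 0 ≤ d ∧ (0 < b ∨ 0 < d)) := by
    intro a b d x y z h hx hy hz
    constructor
    · rintro ⟨ha, hb, hd, hbd⟩
      exact key a b d x y z h ha hb hd hbd hx hy hz
    · rintro ⟨ha, hb, hd, hbd⟩
      refine key (-a) (-b) (-d) x y z (by linarith) (by linarith) (by linarith) (by linarith) ?_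
        hx hy hz
      exact hbd.imp (fun h => by linarith) (fun h => by linarith)
  have r0 := solve _ _ _ _ _ _ s0 (hself 0) a01 a02
  have r1 := solve (c 1) (c 0) (c 2) _ _ _ (by linarith) (hself 1) a10 a12
  have r2 := solve (c 2) (c 0) (c 1) _ _ _ (by linarith) (hself 2) a20 a21
  clear hsum s0 s1 s2 solve key pos a01 a02 a10 a12 a20 a21 q0 q1 q2 hself hother hc hi hdep
  generalize c 0 = c0 at *
  generalize c 1 = c1 at *
  generalize c 2 = c2 at *
  rcases lt_trichotomy c0 0 with h0 | h0 | h0 <;>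
  rcases lt_trichotomy c1 0 with h1 | h1 | h1 <;>
  rcases lt_trichotomy c2 0 with h2 | h2 | h2 <;>
  grind

/-- If finitely many closed halfplanes through `q` cover `S`, then three of them already do. -/
lemma exists_subcover_card_le_three (S W : Finset (EuclideanSpace ℝ (Fin 2)))
    (q : EuclideanSpace ℝ (Fin 2)) (v : EuclideanSpace ℝ (Fin 2) → EuclideanSpace ℝ (Fin 2))
    (hW : ∀ p ∈ S, ∃ w ∈ W, ⟪v w, p - q⟫ ≤ 0) :
    ∃ U ⊆ W, U.card ≤ 3 ∧ ∀ p ∈ S, ∃ w ∈ U, ⟪v w, p - q⟫ ≤ 0 := by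
  classical
  induction W using Finset.strongInduction with
  | H W ih =>
    by_cases hcard : W.card ≤ 3
    · exact ⟨W, subset_rfl, hcard, hW⟩
    by_cases hred : ∃ w ∈ W, ∀ p ∈ S, ∃ w' ∈ W.erase w, ⟪v w', p - q⟫ ≤ 0
    · obtain ⟨w, hw, hcov⟩ := hred
      obtain ⟨U, hU, h⟩ := ih _ (Finset.erase_ssubset hw) hcov
      exact ⟨U, hU.trans (Finset.erase_subset _ _), h⟩
    push Not at hred
    choose! x hxS hx using hred
    obtain ⟨F, hFW, hF⟩ := Finset.exists_subset_card_eq (show 4 ≤ W.card by omega)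
    let e := (F.equivFinOfCardEq hF).symm
    have heW : ∀ i, (e i : EuclideanSpace ℝ (Fin 2)) ∈ W := fun i => hFW (e i).2
    refine (false_of_four_private_points (fun i => v (e i)) (fun i => x (e i) - q) ?_ ?_).elim
    · intro i
      obtain ⟨w, hw, hwx⟩ := hW _ (hxS _ (heW i))
      by_cases h : w = e i
      · rwa [h] at hwx
      · exact absurd (hx _ (heW i) w (Finset.mem_erase.2 ⟨h, hw⟩)) (not_lt.2 hwx)
    · intro i j hij
      refine hx _ (heW i) _ (Finset.mem_erase.2 ⟨fun h => hij ?_, heW j⟩)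
      exact e.injective (Subtype.ext h)

lemma HasDepthAtLeast.exists_erase {S : Finset (EuclideanSpace ℝ (Fin 2))}
    {q : EuclideanSpace ℝ (Fin 2)} {m : ℕ} (h : HasDepthAtLeast S q m) (hcard : 3 * m < S.card) :
    ∃ p ∈ S, HasDepthAtLeast (S.erase p) q m := by
  classical
  by_contra! hcon
  simp only [HasDepthAtLeast, not_forall, not_le] at hcon
  choose! v hv0 hv using hcon
  have hmem : ∀ p ∈ S, ⟪v p, p - q⟫ ≤ 0 ∧ (S.filter fun x => ⟪v p, x - q⟫ ≤ 0).card ≤ m := by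
    intro p hp
    have h1 := hv p hp
    rw [Finset.filter_erase] at h1
    have h2 := h (v p) (hv0 p hp)
    refine ⟨?_, ?_⟩
    · by_contra hn
      rw [Finset.erase_eq_of_notMem (by simp [hn])] at h1
      omega
    · have := Finset.pred_card_le_card_erase (s := S.filter fun x => ⟪v p, x - q⟫ ≤ 0) (a := p)
      omega
  obtain ⟨U, hUS, hU3, hU⟩ := exists_subcover_card_le_three S S q v
    fun p hp => ⟨p, hp, (hmem p hp).1⟩
  have hsub : S ⊆ U.biUnion fun w => S.filter fun x => ⟪v w, x - q⟫ ≤ 0 := by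
    intro p hp
    obtain ⟨w, hw, hwp⟩ := hU p hp
    exact Finset.mem_biUnion.2 ⟨w, hw, Finset.mem_filter.2 ⟨hp, hwp⟩⟩
  have h1 := Finset.card_le_card hsub
  have h2 := Finset.card_biUnion_le_card_mul U
    (fun w => S.filter fun x => ⟪v w, x - q⟫ ≤ 0) m fun w hw => (hmem w (hUS hw)).2
  have h3 := Nat.mul_le_mul_right m hU3
  omega

lemma HasDepthAtLeast.exists_subset_card_eq {S : Finset (EuclideanSpace ℝ (Fin 2))}
    {q : EuclideanSpace ℝ (Fin 2)} {m : ℕ} (h : HasDepthAtLeast S q m) (hcard : 3 * m ≤ S.card) :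
    ∃ U ⊆ S, U.card = 3 * m ∧ HasDepthAtLeast U q m := by
  classical
  induction S using Finset.strongInduction with
  | H S ih =>
    rcases hcard.eq_or_lt with heq | hlt
    · exact ⟨S, subset_rfl, heq.symm, h⟩
    obtain ⟨p, hp, hd⟩ := h.exists_erase hlt
    obtain ⟨U, hU, hrest⟩ := ih _ (Finset.erase_ssubset hp) hd
      (by rw [Finset.card_erase_of_mem hp]; omega)
    exact ⟨U, hU.trans (Finset.erase_subset _ _), hrest⟩

/-- The polar angle of a vector of the plane, in `(-π, π]`. -/
noncomputable def polarAngle (x : EuclideanSpace ℝ (Fin 2)) : ℝ :=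
  Complex.arg ⟨x 0, x 1⟩

lemma exists_polar {x : EuclideanSpace ℝ (Fin 2)} (hx : x ≠ 0) :
    ∃ r : ℝ, 0 < r ∧ x 0 = r * Real.cos (polarAngle x) ∧ x 1 = r * Real.sin (polarAngle x) := by
  refine ⟨‖(⟨x 0, x 1⟩ : ℂ)‖, ?_, ?_, ?_⟩
  · rw [norm_pos_iff]
    intro h
    apply hx
    ext i
    fin_cases i
    · simpa using congrArg Complex.re h
    · simpa using congrArg Complex.im h
  · exact (Complex.norm_mul_cos_arg ⟨x 0, x 1⟩).symm
  · exact (Complex.norm_mul_sin_arg ⟨x 0, x 1⟩).symm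

lemma inner_polar {x : EuclideanSpace ℝ (Fin 2)} {r : ℝ} (φ θ : ℝ)
    (h0 : x 0 = r * Real.cos θ) (h1 : x 1 = r * Real.sin θ) :
    ⟪(!₂[Real.cos φ, Real.sin φ] : EuclideanSpace ℝ (Fin 2)), x⟫ = r * Real.cos (θ - φ) := by
  simp [PiLp.inner_apply, Fin.sum_univ_two, h0, h1, Real.cos_sub]
  ring

lemma unit_vector_ne_zero (φ : ℝ) :
    (!₂[Real.cos φ, Real.sin φ] : EuclideanSpace ℝ (Fin 2)) ≠ 0 := by
  intro h
  have h0 : Real.cos φ = 0 := by simpa using congrArg (fun x => x 0) h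
  have h1 : Real.sin φ = 0 := by simpa using congrArg (fun x => x 1) h
  have := Real.sin_sq_add_cos_sq φ
  simp [h0, h1] at this

/-- If no halfplane of directions avoids the three angles, nonnegative weights balance them. -/
lemma exists_balancing_weights {a b c : ℝ} (hab : a ≤ b) (hbc : b ≤ c) (h1 : b - a ≤ Real.pi)
    (h2 : c - b ≤ Real.pi) (h3 : Real.pi ≤ c - a) (h4 : c - a < 2 * Real.pi) :
    ∃ u v w : ℝ, 0 ≤ u ∧ 0 ≤ v ∧ 0 ≤ w ∧ 0 < u + v + w ∧
      u * Real.cos a + v * Real.cos b + w * Real.cos c = 0 ∧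
      u * Real.sin a + v * Real.sin b + w * Real.sin c = 0 := by
  have hπ := Real.pi_pos
  rcases h3.eq_or_lt with h | h
  · obtain rfl : c = a + Real.pi := by linarith
    exact ⟨1, 0, 1, by simp, by simp, by simp, by norm_num, by simp [Real.cos_add_pi],
      by simp [Real.sin_add_pi]⟩
  · have hneg : 0 < Real.sin (c - a - Real.pi) :=
      Real.sin_pos_of_pos_of_lt_pi (by linarith) (by linarith)
    rw [Real.sin_sub_pi] at hneg
    have hu := Real.sin_nonneg_of_nonneg_of_le_pi (sub_nonneg.2 hbc) h2
    have hw := Real.sin_nonneg_of_nonneg_of_le_pi (sub_nonneg.2 hab) h1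
    refine ⟨Real.sin (c - b), -Real.sin (c - a), Real.sin (b - a), hu, hneg.le, hw,
      by linarith, ?_, ?_⟩ <;> simp only [Real.sin_sub] <;> ring

lemma mem_convexHull_of_polarAngle {q x y z : EuclideanSpace ℝ (Fin 2)}
    (hx : x ≠ q) (hy : y ≠ q) (hz : z ≠ q)
    (hab : polarAngle (x - q) ≤ polarAngle (y - q)) (hbc : polarAngle (y - q) ≤ polarAngle (z - q))
    (h1 : polarAngle (y - q) - polarAngle (x - q) ≤ Real.pi)
    (h2 : polarAngle (z - q) - polarAngle (y - q) ≤ Real.pi)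
    (h3 : Real.pi ≤ polarAngle (z - q) - polarAngle (x - q)) :
    q ∈ convexHull ℝ ({x, y, z} : Set (EuclideanSpace ℝ (Fin 2))) := by
  have h4 : polarAngle (z - q) - polarAngle (x - q) < 2 * Real.pi := by
    have := Complex.neg_pi_lt_arg ⟨(x - q) 0, (x - q) 1⟩
    have := Complex.arg_le_pi ⟨(z - q) 0, (z - q) 1⟩
    unfold polarAngle
    linarith
  obtain ⟨u, v, w, hu, hv, hw, hs, hc, hsn⟩ := exists_balancing_weights hab hbc h1 h2 h3 h4
  obtain ⟨r, hr, hx0, hx1⟩ := exists_polar (sub_ne_zero.2 hx)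
  obtain ⟨s, hs', hy0, hy1⟩ := exists_polar (sub_ne_zero.2 hy)
  obtain ⟨t, ht, hz0, hz1⟩ := exists_polar (sub_ne_zero.2 hz)
  have hu' : 0 ≤ u / r := by positivity
  have hv' : 0 ≤ v / s := by positivity
  have hw' : 0 ≤ w / t := by positivity
  have hW : 0 < u / r + v / s + w / t := by
    rcases hu.eq_or_lt with h | h
    · rcases hv.eq_or_lt with h' | h'
      · have : 0 < w := by linarith
        positivity
      · positivity
    · positivity
  have hzero : (u / r) • (x - q) + (v / s) • (y - q) + (w / t) • (z - q) = 0 := by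
    ext i
    fin_cases i
    · simp only [Fin.zero_eta, PiLp.add_apply, PiLp.smul_apply, smul_eq_mul, hx0, hy0, hz0,
        PiLp.zero_apply]
      rw [← hc]
      field_simp
    · simp only [Fin.mk_one, PiLp.add_apply, PiLp.smul_apply, smul_eq_mul, hx1, hy1, hz1,
        PiLp.zero_apply]
      rw [← hsn]
      field_simp
  set A := u / r
  set B := v / s
  set C := w / t
  have hq : q = (A / (A + B + C)) • x + (B / (A + B + C)) • y + (C / (A + B + C)) • z := by
    have hsum : (A + B + C) • q = A • x + B • y + C • z := by
      rw [← sub_eq_zero, ← neg_eq_zero, ← hzero]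
      module
    rw [← inv_smul_smul₀ hW.ne' q, hsum]
    simp only [smul_add, smul_smul, div_eq_inv_mul]
  have hconv := convex_convexHull ℝ ({x, y, z} : Set (EuclideanSpace ℝ (Fin 2)))
  have hsub := subset_convexHull ℝ ({x, y, z} : Set (EuclideanSpace ℝ (Fin 2)))
  have hmem := hconv.sum_mem (t := Finset.univ)
    (w := ![A / (A + B + C), B / (A + B + C), C / (A + B + C)]) (z := ![x, y, z])
    (by intro i _; fin_cases i <;> simp <;> positivity)
    (by simp [Fin.sum_univ_three]; field_simp)
    (by intro i _; fin_cases i <;> exact hsub (by simp))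
  rw [hq]
  simpa [Fin.sum_univ_three] using hmem

theorem HasDepthAtLeast.exists_triples {S : Finset (EuclideanSpace ℝ (Fin 2))}
    {q : EuclideanSpace ℝ (Fin 2)} {m : ℕ} (h : HasDepthAtLeast S q m) (hq : q ∉ S)
    (hcard : S.card = 3 * m) :
    ∃ T : Fin m → Finset (EuclideanSpace ℝ (Fin 2)),
      (∀ i, T i ⊆ S) ∧
      (∀ i, (T i).card = 3) ∧
      (∀ i j, i ≠ j → Disjoint (T i) (T j)) ∧
      ∀ i, q ∈ convexHull ℝ (T i : Set (EuclideanSpace ℝ (Fin 2))) := by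
  classical
  obtain ⟨g, hinj, hS, hmono⟩ : ∃ g : Fin (3 * m) → EuclideanSpace ℝ (Fin 2),
      Function.Injective g ∧ (∀ x, x ∈ S ↔ ∃ i, g i = x) ∧
      Monotone fun i => polarAngle (g i - q) := by
    let e := (S.equivFinOfCardEq hcard).symm
    let f : Fin (3 * m) → ℝ := fun i => polarAngle ((e i : EuclideanSpace ℝ (Fin 2)) - q)
    refine ⟨fun i => e (Tuple.sort f i), ?_, ?_, Tuple.monotone_sort f⟩
    · exact Subtype.val_injective.comp (e.injective.comp (Tuple.sort f).injective)
    · intro x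
      constructor
      · intro hx
        exact ⟨(Tuple.sort f).symm (e.symm ⟨x, hx⟩), by simp⟩
      · rintro ⟨i, rfl⟩
        exact (e _).2
  have hgS : ∀ i, g i ∈ S := fun i => (hS _).2 ⟨i, rfl⟩
  have hne : ∀ i, g i ≠ q := fun i hi => hq (hi ▸ hgS i)
  have hlow : ∀ i, -Real.pi < polarAngle (g i - q) := fun i => Complex.neg_pi_lt_arg _
  have hhigh : ∀ i, polarAngle (g i - q) ≤ Real.pi := fun i => Complex.arg_le_pi _
  have hπ := Real.pi_pos
  have hcount : ∀ (v : EuclideanSpace ℝ (Fin 2)) (J : Finset (Fin (3 * m))), v ≠ 0 →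
      (∀ l, ⟪v, g l - q⟫ ≤ 0 → l ∈ J) → m ≤ J.card := by
    intro v J hv hJ
    refine (h v hv).trans ((Finset.card_le_card ?_).trans (Finset.card_image_le (s := J) (f := g)))
    intro x hx
    obtain ⟨hxS, hx⟩ := Finset.mem_filter.1 hx
    obtain ⟨l, rfl⟩ := (hS x).1 hxS
    exact Finset.mem_image_of_mem g (hJ l hx)
  have hgap : ∀ i j : Fin (3 * m), i ≤ j → (j : ℕ) ≤ i + m →
      polarAngle (g j - q) - polarAngle (g i - q) ≤ Real.pi := by
    intro i j hij hjm
    by_contra! hlt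
    set φ := (polarAngle (g i - q) + polarAngle (g j - q)) / 2 with hφ
    have := hcount (-!₂[Real.cos φ, Real.sin φ]) (Finset.Ioo i j)
      (neg_ne_zero.2 (unit_vector_ne_zero φ)) ?_
    · rw [Fin.card_Ioo] at this
      have : i ≠ j := by
        rintro rfl
        linarith
      have : (i : ℕ) ≠ j := fun h => this (Fin.ext h)
      omega
    · intro l hl
      obtain ⟨r, hr, h0, h1⟩ := exists_polar (sub_ne_zero.2 (hne l))
      rw [inner_neg_left, inner_polar φ _ h0 h1, neg_nonpos] at hl
      have hl := nonneg_of_mul_nonneg_right hl hr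
      have := hlow i
      have := hlow l
      have := hhigh j
      have := hhigh l
      by_contra hmem
      rw [Finset.mem_Ioo, not_and_or, not_lt, not_lt] at hmem
      rcases hmem with hmem | hmem
      · have hm : polarAngle (g l - q) ≤ polarAngle (g i - q) := hmono hmem
        have := Real.cos_neg_of_pi_div_two_lt_of_lt
          (x := φ - polarAngle (g l - q)) (by linarith) (by linarith)
        rw [← Real.cos_neg, neg_sub] at this
        linarith
      · have hm : polarAngle (g j - q) ≤ polarAngle (g l - q) := hmono hmem
        have := Real.cos_neg_of_pi_div_two_lt_of_lt
          (x := polarAngle (g l - q) - φ) (by linarith) (by linarith)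
        linarith
  have hspan : ∀ i j : Fin (3 * m), (j : ℕ) = i + 2 * m →
      Real.pi ≤ polarAngle (g j - q) - polarAngle (g i - q) := by
    intro i j hj
    by_contra! hlt
    set φ := (polarAngle (g i - q) + polarAngle (g j - q)) / 2 with hφ
    have := hcount (!₂[Real.cos φ, Real.sin φ]) (Finset.Icc i j)ᶜ (unit_vector_ne_zero φ) ?_
    · rw [Finset.card_compl, Fin.card_Icc, Fintype.card_fin] at this
      omega
    · intro l hl
      obtain ⟨r, hr, h0, h1⟩ := exists_polar (sub_ne_zero.2 (hne l))
      rw [inner_polar φ _ h0 h1] at hl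
      rw [Finset.mem_compl, Finset.mem_Icc]
      rintro ⟨hil, hlj⟩
      have h1 : polarAngle (g i - q) ≤ polarAngle (g l - q) := hmono hil
      have h2 : polarAngle (g l - q) ≤ polarAngle (g j - q) := hmono hlj
      have := Real.cos_pos_of_mem_Ioo (x := polarAngle (g l - q) - φ)
        ⟨by linarith, by linarith⟩
      exact absurd hl (not_le.2 (mul_pos hr this))
  let t : Fin m → Fin 3 → Fin (3 * m) := fun i s => ⟨i + s * m, by
    have := Nat.mul_le_mul_right m (Nat.le_of_lt_succ s.2)
    omega⟩
  have htinj : ∀ i j s s', t i s = t j s' → i = j ∧ s = s' := by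
    intro i j s s' hij
    have hij : (i : ℕ) + s * m = j + s' * m := congrArg Fin.val hij
    have hi := i.2
    have hj := j.2
    fin_cases s <;> fin_cases s' <;> simp at hij ⊢ <;> omega
  refine ⟨fun i => Finset.univ.image fun s => g (t i s), ?_, ?_, ?_, ?_⟩
  · intro i x hx
    obtain ⟨s, -, rfl⟩ := Finset.mem_image.1 hx
    exact hgS _
  · intro i
    rw [Finset.card_image_of_injective _ fun s s' hs => (htinj _ _ _ _ (hinj hs)).2]
    simp
  · intro i j hij
    rw [Finset.disjoint_left]
    intro x hx hx'
    obtain ⟨s, -, rfl⟩ := Finset.mem_image.1 hx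
    obtain ⟨s', -, hs⟩ := Finset.mem_image.1 hx'
    exact hij (htinj _ _ _ _ (hinj hs)).1.symm
  · intro i
    have hset : ((Finset.univ.image fun s => g (t i s) : Finset (EuclideanSpace ℝ (Fin 2))) :
        Set (EuclideanSpace ℝ (Fin 2))) = {g (t i 0), g (t i 1), g (t i 2)} := by
      ext x
      simp [Fin.exists_fin_succ, eq_comm]
    have h01 : t i 0 ≤ t i 1 := by simp [t, Fin.le_def]
    have h12 : t i 1 ≤ t i 2 := by
      simp only [t, Fin.le_def]
      simp
      omega
    rw [hset]
    refine mem_convexHull_of_polarAngle (hne _) (hne _) (hne _) (hmono h01) (hmono h12)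
      (hgap _ _ h01 ?_) (hgap _ _ h12 ?_) (hspan _ _ ?_)
    · simp [t]
    · simp [t]
      omega
    · simp [t]

/-- Let `P` be a set of `n` points in the plane and `q ∉ P` a point such that `P ∪ {q}`
is in general position (no three points collinear), and let `k` be the Tukey depth of `q`
with respect to `P`. Then there are `τ = min(⌊n/3⌋, k)` pairwise disjoint triples of
points of `P` whose convex hulls all contain `q`. -/
theorem tverberg_triples_of_tukey (n k : ℕ)
    (P : Finset (EuclideanSpace ℝ (Fin 2))) (hP : P.card = n)
    (q : EuclideanSpace ℝ (Fin 2)) (hq : q ∉ P)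
    (hgp : ∀ x ∈ insert q (P : Set (EuclideanSpace ℝ (Fin 2))),
      ∀ y ∈ insert q (P : Set (EuclideanSpace ℝ (Fin 2))),
      ∀ z ∈ insert q (P : Set (EuclideanSpace ℝ (Fin 2))),
      x ≠ y → x ≠ z → y ≠ z →
        ¬ Collinear ℝ ({x, y, z} : Set (EuclideanSpace ℝ (Fin 2))))
    (hdepth : tukeyDepth (P : Set (EuclideanSpace ℝ (Fin 2))) q = k) :
    ∃ T : Fin (min (n / 3) k) → Finset (EuclideanSpace ℝ (Fin 2)),
      (∀ i, T i ⊆ P) ∧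
      (∀ i, (T i).card = 3) ∧
      (∀ i j, i ≠ j → Disjoint (T i) (T j)) ∧
      ∀ i, q ∈ convexHull ℝ (T i : Set (EuclideanSpace ℝ (Fin 2))) := by
  have hP' : HasDepthAtLeast P q (min (n / 3) k) := fun v hv =>
    (min_le_right _ _).trans (hdepth ▸ hasDepthAtLeast_tukeyDepth P q v hv)
  obtain ⟨U, hUP, hU, hUd⟩ := hP'.exists_subset_card_eq (by omega)
  obtain ⟨T, hT, hrest⟩ := hUd.exists_triples (fun h => hq (hUP h)) hU
  exact ⟨T, fun i => (hT i).trans hUP, hrest⟩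
end

section
/- Let d ≥ 2 be an even integer and let P be a set of n points in ℝ^d. Then there exist a point q ∈ ℝ^d and ⌊n/3^{d/2}⌋ pairwise disjoint subsets of P, each of size at most d+1, such that the convex hull of each subset contains q. -/
/-- A point of minimal norm in the convex hull of more than `dim V` points lies in the convex hull
of all but one of them, provided it is nonzero. -/
lemma exists_mem_convexHull_image_compl_of_inner_le {V ι : Type*} [NormedAddCommGroup V]
    [InnerProductSpace ℝ V] [FiniteDimensional ℝ V] [Fintype ι]
    (hcard : Module.finrank ℝ V < Fintype.card ι) (y : ι → V) (x : V) (hx0 : x ≠ 0)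
    (hx : x ∈ convexHull ℝ (Set.range y)) (hy : ∀ i, inner ℝ x x ≤ inner ℝ (y i) x) :
    ∃ i₀, x ∈ convexHull ℝ (y '' {i₀}ᶜ) := by
  classical
  have key : ∀ (w : ι → ℝ) (i₀ : ι), (∀ i, 0 ≤ w i) → ∑ i, w i = 1 → ∑ i, w i • y i = x →
      w i₀ = 0 → x ∈ convexHull ℝ (y '' {i₀}ᶜ) := by
    intro w i₀ h0 h1 hw hi
    have hs : ∑ i ∈ Finset.univ.erase i₀, w i = 1 := by
      rw [← h1]; exact Finset.sum_erase _ hi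
    have hs' : ∑ i ∈ Finset.univ.erase i₀, w i • y i = x := by
      rw [← hw]; exact Finset.sum_erase _ (by simp [hi])
    rw [← hs']
    refine (convex_convexHull ℝ _).sum_mem (fun i _ => h0 i) hs fun i hi => ?_
    exact subset_convexHull ℝ _ ⟨i, by simpa using hi, rfl⟩
  rw [convexHull_range_eq_exists_affineCombination] at hx
  obtain ⟨s, w', h0', h1', hw'⟩ := hx
  rw [Finset.affineCombination_eq_linear_combination _ _ _ h1'] at hw'
  obtain ⟨w, h0, h1, hw⟩ : ∃ w : ι → ℝ, (∀ i, 0 ≤ w i) ∧ ∑ i, w i = 1 ∧ ∑ i, w i • y i = x := by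
    refine ⟨fun i => if i ∈ s then w' i else 0, fun i => ?_, ?_, ?_⟩
    · dsimp only
      split_ifs with h
      exacts [h0' i h, le_rfl]
    · simpa using h1'
    · simpa [ite_smul] using hw'
  by_cases hz : ∃ i, w i = 0
  · obtain ⟨i, hi⟩ := hz
    exact ⟨i, key w i h0 h1 hw hi⟩
  push Not at hz
  have hsum : ∑ i, w i * (inner ℝ (y i) x - inner ℝ x x) = 0 := by
    simp only [mul_sub, Finset.sum_sub_distrib, ← Finset.sum_mul, h1, one_mul]
    have : inner ℝ x x = ∑ i, w i * inner ℝ (y i) x := by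
      conv_lhs => arg 2; rw [← hw]
      simp [sum_inner, inner_smul_left]
    rw [this, sub_self]
  have heq : ∀ i, inner ℝ (y i) x = inner ℝ x x := by
    intro i
    have := (Finset.sum_eq_zero_iff_of_nonneg
      (fun i _ => mul_nonneg (h0 i) (sub_nonneg.2 (hy i)))).1 hsum i (Finset.mem_univ i)
    rcases mul_eq_zero.1 this with h | h
    · exact absurd h (hz i)
    · linarith
  have hdep : ¬ LinearIndependent ℝ y := fun h => absurd h.fintype_card_le_finrank (by omega)
  obtain ⟨μ, hμ, k, hk⟩ := Fintype.not_linearIndependent_iff.1 hdep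
  have hμ0 : ∑ i, μ i = 0 := by
    have h : inner ℝ (∑ i, μ i • y i) x = 0 := by rw [hμ, inner_zero_left]
    rw [sum_inner] at h
    simp only [inner_smul_left, heq, ← Finset.sum_mul] at h
    rcases mul_eq_zero.1 h with h | h
    · simpa using h
    · exact absurd (inner_self_eq_zero.1 h) hx0
  obtain ⟨m, -, hm⟩ := Finset.exists_pos_of_sum_zero_of_exists_nonzero μ hμ0
    ⟨k, Finset.mem_univ k, hk⟩
  obtain ⟨i₀, hi₀, hmin⟩ := Finset.exists_min_image (Finset.univ.filter fun i => 0 < μ i)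
    (fun i => w i / μ i) ⟨m, by simpa using hm⟩
  simp only [Finset.mem_filter, Finset.mem_univ, true_and] at hi₀ hmin
  refine ⟨i₀, key (fun i => w i - w i₀ / μ i₀ * μ i) i₀ (fun i => ?_) ?_ ?_ ?_⟩
  · rcases lt_or_ge 0 (μ i) with h | h
    · have := (le_div_iff₀ h).1 (hmin i h)
      linarith
    · have := mul_nonneg (div_nonneg (h0 i₀) hi₀.le) (neg_nonneg.2 h)
      linarith [h0 i]
  · simp [Finset.sum_sub_distrib, ← Finset.mul_sum, hμ0, h1]
  · simp [sub_smul, Finset.sum_sub_distrib, mul_smul, ← Finset.smul_sum, hμ, hw]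
  · field_simp
    ring

/-- **Bárány's colorful Carathéodory theorem** in an inner product space. -/
theorem exists_zero_mem_convexHull_range_of_inner {V ι J : Type*} [NormedAddCommGroup V]
    [InnerProductSpace ℝ V] [FiniteDimensional ℝ V] [Fintype ι] [Finite J]
    (hcard : Module.finrank ℝ V < Fintype.card ι) (c : ι → J → V)
    (hc : ∀ i, 0 ∈ convexHull ℝ (Set.range (c i))) :
    ∃ f : ι → J, 0 ∈ convexHull ℝ (Set.range fun i => c i (f i)) := by
  classical
  have hι : Nonempty ι := Fintype.card_pos_iff.1 (by omega)
  have hJ : Nonempty J := by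
    obtain ⟨i⟩ := hι
    have : (Set.range (c i)).Nonempty := convexHull_nonempty_iff.1 ⟨0, hc i⟩
    exact Set.range_nonempty_iff_nonempty.1 this
  obtain ⟨f, hf⟩ := Finite.exists_min fun f : ι → J =>
    Metric.infDist 0 (convexHull ℝ (Set.range fun i => c i (f i)))
  refine ⟨f, ?_⟩
  have hcomp : IsCompact (convexHull ℝ (Set.range fun i => c i (f i))) :=
    (Set.finite_range _).isCompact_convexHull ℝ
  obtain ⟨x, hxK, hx⟩ := hcomp.exists_infDist_eq_dist
    (convexHull_nonempty_iff.2 (Set.range_nonempty _)) 0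
  have hinner : ∀ g : ι → J, x ∈ convexHull ℝ (Set.range fun i => c i (g i)) →
      ∀ i, inner ℝ x x ≤ inner ℝ (c i (g i)) x := by
    intro g hg i
    have hmin : Metric.infDist 0 (convexHull ℝ (Set.range fun i => c i (g i))) = dist 0 x :=
      le_antisymm (Metric.infDist_le_dist_of_mem hg) (hx ▸ hf g)
    rw [Metric.infDist_eq_iInf] at hmin
    simp only [dist_eq_norm] at hmin
    have := (norm_eq_iInf_iff_real_inner_le_zero (convex_convexHull ℝ _) hg).1 hmin.symm
      _ (subset_convexHull ℝ _ ⟨i, rfl⟩)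
    rw [zero_sub, inner_neg_left, inner_sub_right, real_inner_comm] at this
    linarith
  by_cases hx0 : x = 0
  · rwa [hx0] at hxK
  exfalso
  obtain ⟨i₀, hi₀⟩ := exists_mem_convexHull_image_compl_of_inner_le hcard _ x hx0 hxK
    (hinner f hxK)
  obtain ⟨j, hj⟩ : ∃ j, inner ℝ (c i₀ j) x ≤ 0 := by
    by_contra! h
    have hconv : Convex ℝ {v : V | 0 < inner ℝ v x} := by
      intro a ha b hb s t hs ht hst
      simp only [Set.mem_ofPred_eq, inner_add_left, inner_smul_left] at *
      exact (convex_Ioi (0 : ℝ)) ha hb hs ht hst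
    have hsub : Set.range (c i₀) ⊆ {v : V | 0 < inner ℝ v x} := Set.range_subset_iff.2 h
    have := convexHull_min hsub hconv (hc i₀)
    simp at this
  have hmem : x ∈ convexHull ℝ (Set.range fun i => c i (Function.update f i₀ j i)) := by
    refine convexHull_mono ?_ hi₀
    rintro _ ⟨i, hi, rfl⟩
    exact ⟨i, by simp [Function.update_of_ne (show i ≠ i₀ from hi)]⟩
  have := hinner _ hmem i₀
  rw [Function.update_self] at this
  exact absurd (this.trans hj) (not_le.2 (real_inner_self_pos.2 hx0))

lemma zero_mem_convexHull_range_linearEquiv_iff {V W α : Type*} [AddCommGroup V] [Module ℝ V]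
    [AddCommGroup W] [Module ℝ W] (e : V ≃ₗ[ℝ] W) (g : α → V) :
    0 ∈ convexHull ℝ (Set.range fun a => e (g a)) ↔ 0 ∈ convexHull ℝ (Set.range g) := by
  have h : (Set.range fun a => e (g a)) = e.toLinearMap '' Set.range g := by
    rw [← Set.range_comp]; rfl
  rw [h, ← e.toLinearMap.image_convexHull]
  simp

/-- **Bárány's colorful Carathéodory theorem**: if each of more than `dim V` finite color classes
has the origin in its convex hull, then so does some rainbow selection. -/
theorem exists_zero_mem_convexHull_range {V ι J : Type*} [AddCommGroup V]
    [Module ℝ V] [FiniteDimensional ℝ V] [Fintype ι] [Finite J]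
    (hcard : Module.finrank ℝ V < Fintype.card ι) (c : ι → J → V)
    (hc : ∀ i, 0 ∈ convexHull ℝ (Set.range (c i))) :
    ∃ f : ι → J, 0 ∈ convexHull ℝ (Set.range fun i => c i (f i)) := by
  let e : V ≃ₗ[ℝ] EuclideanSpace ℝ (Fin (Module.finrank ℝ V)) :=
    LinearEquiv.ofFinrankEq _ _ (by simp)
  obtain ⟨f, hf⟩ := exists_zero_mem_convexHull_range_of_inner (by simpa using hcard)
    (fun i j => e (c i j)) fun i => (zero_mem_convexHull_range_linearEquiv_iff e _).2 (hc i)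
  exact ⟨f, (zero_mem_convexHull_range_linearEquiv_iff e _).1 hf⟩

/-- **Tverberg's theorem**, by Sarkaria's argument. -/
theorem exists_tverberg_partition {E ι : Type*} [AddCommGroup E] [Module ℝ E]
    [FiniteDimensional ℝ E] [Fintype ι] (s : ℕ)
    (hcard : s * (Module.finrank ℝ E + 1) < Fintype.card ι) (p : ι → E) :
    ∃ (f : ι → Option (Fin s)) (q : E), ∀ j, q ∈ convexHull ℝ (p '' (f ⁻¹' {j})) := by
  classical
  let c : ι → Option (Fin s) → Fin s → E × ℝ := fun i j k =>
    (if j = some k then (p i, 1) else 0) - (if j = none then (p i, 1) else 0)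
  obtain ⟨f, hf⟩ := exists_zero_mem_convexHull_range (by
      rw [Module.finrank_pi_fintype]
      simpa using hcard) c fun i => by
    have hsum : ∑ j : Option (Fin s), c i j = 0 := by
      ext k : 1
      simp [c, Finset.sum_apply, Finset.sum_sub_distrib]
    have := (convex_convexHull ℝ (Set.range (c i))).sum_mem
      (t := Finset.univ) (w := fun _ => ((s : ℝ) + 1)⁻¹) (z := c i)
      (fun _ _ => by positivity) (by simp; field_simp)
      (fun j _ => subset_convexHull ℝ _ ⟨j, rfl⟩)
    rwa [← Finset.smul_sum, hsum, smul_zero] at this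
  rw [convexHull_range_eq_exists_affineCombination] at hf
  obtain ⟨S, w, h0, h1, hw⟩ := hf
  rw [Finset.affineCombination_eq_linear_combination _ _ _ h1] at hw
  have hgroup : ∀ j, ∑ i ∈ S with f i = j, w i • ((p i, 1) : E × ℝ) =
      ∑ i ∈ S with f i = none, w i • ((p i, 1) : E × ℝ) := by
    rintro (_ | k)
    · rfl
    · have := congrFun hw k
      simp only [Finset.sum_apply, Pi.smul_apply, c, smul_sub, smul_ite, smul_zero,
        Finset.sum_sub_distrib, Pi.zero_apply, ← Finset.sum_filter] at this
      exact sub_eq_zero.1 this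
  have ha : ∀ j, ∑ i ∈ S with f i = j, w i = ∑ i ∈ S with f i = none, w i := fun j => by
    simpa [Prod.snd_sum] using congrArg Prod.snd (hgroup j)
  have hb : ∀ j, ∑ i ∈ S with f i = j, w i • p i = ∑ i ∈ S with f i = none, w i • p i :=
    fun j => by simpa [Prod.fst_sum] using congrArg Prod.fst (hgroup j)
  have hpos : 0 < ∑ i ∈ S with f i = none, w i := by
    have hnn : 0 ≤ ∑ i ∈ S with f i = none, w i :=
      Finset.sum_nonneg fun i hi => h0 i (Finset.mem_filter.1 hi).1
    refine hnn.lt_of_ne fun h => ?_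
    have := Finset.sum_fiberwise S f w
    simp [ha, ← h, h1] at this
  refine ⟨f, Finset.centerMass (S.filter fun i => f i = none) w p, fun j => ?_⟩
  have : Finset.centerMass (S.filter fun i => f i = none) w p =
      Finset.centerMass (S.filter fun i => f i = j) w p := by
    simp only [Finset.centerMass, ha j, hb j]
  rw [this]
  refine Finset.centerMass_mem_convexHull _
    (fun i hi => h0 i (Finset.mem_filter.1 hi).1) (by rwa [ha j]) fun i hi => ?_
  exact ⟨i, (Finset.mem_filter.1 hi).2, rfl⟩

/-- **Carathéodory's theorem** with the cardinality bound made explicit. -/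
lemma exists_finset_card_le_mem_convexHull {E : Type*} [AddCommGroup E] [Module ℝ E]
    [FiniteDimensional ℝ E] {A : Set E} {q : E} (hq : q ∈ convexHull ℝ A) :
    ∃ t : Finset E, (t : Set E) ⊆ A ∧ t.card ≤ Module.finrank ℝ E + 1 ∧
      q ∈ convexHull ℝ (t : Set E) := by
  rw [convexHull_eq_union] at hq
  simp only [Set.mem_iUnion] at hq
  obtain ⟨t, ht, hind, hqt⟩ := hq
  refine ⟨t, ht, ?_, hqt⟩
  have := hind.card_le_finrank_succ.trans (Nat.succ_le_succ (Submodule.finrank_le _))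
  simpa using this

/-- **Tverberg approximation by repeated projection, even dimension.** For `d ≥ 2` even
and any set `P` of `n` points in `ℝ^d`, there are a point `q` and `⌊n / 3^(d/2)⌋` pairwise
disjoint subsets of `P`, each of at most `d + 1` points, whose convex hulls all contain
`q`. -/
theorem tverberg_approx_even_dim (d n : ℕ) (hd : 2 ≤ d) (heven : Even d)
    (P : Finset (EuclideanSpace ℝ (Fin d))) (hP : P.card = n) :
    ∃ (q : EuclideanSpace ℝ (Fin d))
      (Q : Fin (n / 3 ^ (d / 2)) → Finset (EuclideanSpace ℝ (Fin d))),
      (∀ i, Q i ⊆ P) ∧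
      (∀ i, (Q i).card ≤ d + 1) ∧
      (∀ i j, i ≠ j → Disjoint (Q i) (Q j)) ∧
      ∀ i, q ∈ convexHull ℝ (Q i : Set (EuclideanSpace ℝ (Fin d))) := by
  obtain ⟨k, hk⟩ := heven
  have hdk : d / 2 = k := by omega
  have hpow : d + 1 ≤ 3 ^ k := by
    have h := one_add_mul_le_pow (a := (2 : ℤ)) (by norm_num) k
    norm_num at h
    zify
    push_cast [hk]
    linarith
  rw [hdk]
  rcases hr : n / 3 ^ k with _ | s
  · exact ⟨0, fun i => i.elim0, fun i => i.elim0, fun i => i.elim0, fun i => i.elim0,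
      fun i => i.elim0⟩
  have hn : (s + 1) * 3 ^ k ≤ n := hr ▸ Nat.div_mul_le_self n (3 ^ k)
  obtain ⟨f, q, hq⟩ := exists_tverberg_partition s (ι := P) (by
    simp only [finrank_euclideanSpace_fin, Fintype.card_coe, hP]
    nlinarith) Subtype.val
  choose t ht hcard hqt using fun j => exists_finset_card_le_mem_convexHull (hq j)
  refine ⟨q, fun i => t (finSuccEquiv s i), fun i x hx => ?_, fun i => ?_, fun i j hij => ?_,
    fun i => hqt _⟩
  · obtain ⟨y, -, rfl⟩ := ht _ hx
    exact y.2
  · simpa using hcard (finSuccEquiv s i)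
  · rw [Finset.disjoint_left]
    intro x hxi hxj
    obtain ⟨y, hy, rfl⟩ := ht _ hxi
    obtain ⟨z, hz, hzy⟩ := ht _ hxj
    obtain rfl := Subtype.ext hzy
    exact hij ((finSuccEquiv s).injective (hy.symm.trans hz))
end

section
/- Let d ≥ 3 be an odd integer and let P be a set of n points in ℝ^d. Then there exist a point q ∈ ℝ^d and ⌊n/(2·3^{(d-1)/2})⌋ pairwise disjoint subsets of P, each of size at most d+1, such that the convex hull of each subset contains q. -/
/-- A convex combination of linearly dependent vectors, all lying on an affine hyperplane that
misses the origin, can be rewritten with one of its weights equal to zero. -/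
lemma exists_weights_eq_zero_of_finrank_lt {E ι : Type*} [AddCommGroup E] [Module ℝ E] [Fintype ι]
    (S : Submodule ℝ E) [FiniteDimensional ℝ S] (p : ι → E) (hp : ∀ i, p i ∈ S)
    (hcard : Module.finrank ℝ S < Fintype.card ι) (φ : E →ₗ[ℝ] ℝ) {a : ℝ} (ha : a ≠ 0)
    (hφ : ∀ i, φ (p i) = a) {w : ι → ℝ} (hw₀ : ∀ i, 0 ≤ w i) :
    ∃ v : ι → ℝ, (∀ i, 0 ≤ v i) ∧ ∑ i, v i = ∑ i, w i ∧ ∑ i, v i • p i = ∑ i, w i • p i ∧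
      ∃ i, v i = 0 := by
  have hdep : ¬ LinearIndependent ℝ (fun i => (⟨p i, hp i⟩ : S)) := fun h =>
    hcard.not_ge h.fintype_card_le_finrank
  obtain ⟨g, hg, i₁, hi₁⟩ := Fintype.not_linearIndependent_iff.1 hdep
  replace hg : ∑ i, g i • p i = 0 := by simpa using congrArg S.subtype hg
  have hgsum : ∑ i, g i = 0 := by
    have := congrArg φ hg
    simp only [map_sum, map_smul, hφ, smul_eq_mul, map_zero, ← Finset.sum_mul] at this
    exact (mul_eq_zero.1 this).resolve_right ha
  obtain ⟨i₂, -, hi₂⟩ :=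
    Finset.exists_pos_of_sum_zero_of_exists_nonzero g hgsum ⟨i₁, Finset.mem_univ _, hi₁⟩
  obtain ⟨k, hk, hmin⟩ := Finset.exists_min_image (Finset.univ.filter fun i => 0 < g i)
    (fun i => w i / g i) ⟨i₂, by simpa using hi₂⟩
  replace hk : 0 < g k := by simpa using hk
  refine ⟨fun i => w i - w k / g k * g i, fun i => ?_, ?_, ?_, k, ?_⟩
  · rcases lt_or_ge 0 (g i) with h | h
    · have := hmin i (by simpa using h)
      rw [le_div_iff₀ h] at this
      linarith
    · have := mul_nonneg (div_nonneg (hw₀ k) hk.le) (neg_nonneg.2 h)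
      linarith [hw₀ i]
  · simp [Finset.sum_sub_distrib, ← Finset.mul_sum, hgsum]
  · simp [sub_smul, mul_smul, Finset.sum_sub_distrib, ← Finset.smul_sum, hg]
  · simp [hk.ne']

/-- Points of the convex hull of a finite family are convex combinations of that family. -/
lemma exists_weights_of_mem_convexHull_range {E ι : Type*} [AddCommGroup E] [Module ℝ E]
    [Fintype ι] {p : ι → E} {z : E} (hz : z ∈ convexHull ℝ (Set.range p)) :
    ∃ w : ι → ℝ, (∀ i, 0 ≤ w i) ∧ ∑ i, w i = 1 ∧ ∑ i, w i • p i = z := by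
  classical
  have hrange : Set.range p = Fintype.linearCombination ℝ p ''
      Set.range fun i => (Pi.single i 1 : ι → ℝ) := by
    rw [← Set.range_comp]
    congr 1
    ext i
    simp
  rw [hrange, ← LinearMap.image_convexHull, convexHull_rangle_single_eq_stdSimplex] at hz
  obtain ⟨w, ⟨hw₀, hw₁⟩, rfl⟩ := hz
  exact ⟨w, hw₀, hw₁, rfl⟩

/-- An element `z` of minimal norm of a convex set supports that set. -/
lemma sq_norm_le_inner_of_convex {E : Type*} [NormedAddCommGroup E] [InnerProductSpace ℝ E]
    {s : Set E} (hs : Convex ℝ s) {z y : E} (hz : z ∈ s) (hmin : ∀ x ∈ s, ‖z‖ ≤ ‖x‖)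
    (hy : y ∈ s) : ‖z‖ ^ 2 ≤ inner ℝ z y := by
  have : Nonempty s := ⟨z, hz⟩
  have hinf : ‖(0 : E) - z‖ = ⨅ w : s, ‖(0 : E) - w‖ := by
    refine le_antisymm (le_ciInf fun w => by simpa using hmin w w.2) ?_
    exact ciInf_le ⟨0, by rintro _ ⟨w, rfl⟩; positivity⟩ (⟨z, hz⟩ : s)
  have := (norm_eq_iInf_iff_real_inner_le_zero hs hz).1 hinf y hy
  rw [zero_sub, inner_neg_left, inner_sub_right, real_inner_self_eq_norm_sq] at this
  linarith

/-- **Colorful Carathéodory theorem**: if the origin is in the convex hull of each colour class,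
and there are more colours than the dimension of a subspace containing all the points, then the
origin is in the convex hull of a set with one point of each colour. -/
theorem colorful_caratheodory {E ι κ : Type*} [NormedAddCommGroup E] [InnerProductSpace ℝ E]
    [Fintype ι] [Finite κ] (S : Submodule ℝ E) [FiniteDimensional ℝ S] (p : ι → κ → E)
    (hp : ∀ i k, p i k ∈ S) (hcard : Module.finrank ℝ S < Fintype.card ι)
    (h₀ : ∀ i, (0 : E) ∈ convexHull ℝ (Set.range (p i))) :
    ∃ f : ι → κ, (0 : E) ∈ convexHull ℝ (Set.range fun i => p i (f i)) := by
  classical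
  have hι : Nonempty ι := Fintype.card_pos_iff.1 (by omega)
  have hκ : Nonempty κ := by
    by_contra h
    rw [not_nonempty_iff] at h
    simpa [Set.range_eq_empty] using h₀ hι.some
  have hcompact : IsCompact (⋃ f : ι → κ, convexHull ℝ (Set.range fun i => p i (f i))) :=
    isCompact_iUnion fun f => (Set.finite_range _).isCompact_convexHull ℝ
  obtain ⟨z, hz, hmin⟩ := hcompact.exists_isMinOn
    (Set.nonempty_iUnion.2 ⟨Classical.arbitrary _, (Set.range_nonempty _).convexHull⟩)
    continuous_norm.continuousOn
  have hle (f : ι → κ) (hzf : z ∈ convexHull ℝ (Set.range fun i => p i (f i))) (i : ι) :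
      ‖z‖ ^ 2 ≤ inner ℝ z (p i (f i)) :=
    sq_norm_le_inner_of_convex (convex_convexHull ℝ _) hzf
      (fun x hx => hmin (Set.mem_iUnion.2 ⟨f, hx⟩)) (subset_convexHull ℝ _ ⟨i, rfl⟩)
  obtain ⟨f, hf⟩ := Set.mem_iUnion.1 hz
  refine ⟨f, ?_⟩
  by_contra hne
  have hz₀ : 0 < ‖z‖ := norm_pos_iff.2 fun h => hne (h ▸ hf)
  obtain ⟨v, hv₀, hv₁, hvz, i, hvi⟩ : ∃ v : ι → ℝ, (∀ i, 0 ≤ v i) ∧ ∑ i, v i = 1 ∧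
      ∑ i, v i • p i (f i) = z ∧ ∃ i, v i = 0 := by
    obtain ⟨w, hw₀, hw₁, hwz⟩ := exists_weights_of_mem_convexHull_range hf
    by_cases hpos : ∃ i, w i = 0
    · exact ⟨w, hw₀, hw₁, hwz, hpos⟩
    push Not at hpos
    have hsum : ∑ i, w i * (inner ℝ z (p i (f i)) - ‖z‖ ^ 2) = 0 := by
      simp only [mul_sub, Finset.sum_sub_distrib, ← Finset.sum_mul, hw₁,
        ← real_inner_smul_right, ← inner_sum, hwz]
      simp
    have hinner (i : ι) : inner ℝ z (p i (f i)) = ‖z‖ ^ 2 := by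
      have := (Finset.sum_eq_zero_iff_of_nonneg fun i _ =>
        mul_nonneg (hw₀ i) (sub_nonneg.2 (hle f hf i))).1 hsum i (Finset.mem_univ i)
      exact sub_eq_zero.1 ((mul_eq_zero.1 this).resolve_left (hpos i))
    rw [← hw₁, ← hwz]
    exact exists_weights_eq_zero_of_finrank_lt S (fun i => p i (f i)) (fun i => hp i _) hcard
      (innerₗ E z) (pow_pos hz₀ 2).ne' hinner hw₀
  obtain ⟨_, ⟨k, rfl⟩, hk⟩ :=
    ((innerₗ E z).concaveOn convex_univ).exists_le_of_mem_convexHull (Set.subset_univ _) (h₀ i)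
  have hzk : z ∈ convexHull ℝ (Set.range fun j => p j (Function.update f i k j)) := by
    refine mem_convexHull_of_exists_fintype v _ hv₀ hv₁ (fun j => ⟨j, rfl⟩) ?_
    rw [← hvz]
    refine Finset.sum_congr rfl fun j _ => ?_
    rcases eq_or_ne j i with rfl | hji
    · simp [hvi]
    · simp [hji]
  have := hle _ hzk i
  simp only [Function.update_self] at this
  simp only [innerₗ_apply_apply, map_zero] at hk
  nlinarith [pow_pos hz₀ 2]

/-- Sarkaria's lemma: sufficiently many vectors can be coloured so that some convex combination of
them has the same partial sum over every colour class. -/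
lemma exists_coloring_sum_eq {W ι κ : Type*} [NormedAddCommGroup W] [InnerProductSpace ℝ W]
    [FiniteDimensional ℝ W] [Fintype ι] [Fintype κ] [DecidableEq κ] [Nonempty κ] (x : ι → W)
    (hcard : (Fintype.card κ - 1) * Module.finrank ℝ W < Fintype.card ι) :
    ∃ (f : ι → κ) (w : ι → ℝ), (∀ i, 0 ≤ w i) ∧ ∑ i, w i = 1 ∧
      ∃ c : W, ∀ k, ∑ i with f i = k, w i • x i = c := by
  let r : ℝ := Fintype.card κ
  have hr : r ≠ 0 := by simp [r]
  let L : PiLp 2 (fun _ : κ => W) →ₗ[ℝ] W := ∑ k, PiLp.projₗ 2 (fun _ : κ => W) k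
  have hL (y : PiLp 2 (fun _ : κ => W)) : L y = ∑ k, y k := by simp [L]
  have hLsurj : Function.Surjective L := fun y =>
    ⟨WithLp.toLp 2 fun _ => r⁻¹ • y, by
      rw [hL]; simp [← Nat.cast_smul_eq_nsmul ℝ, smul_smul, r]⟩
  have hfin : Module.finrank ℝ (LinearMap.ker L) = (Fintype.card κ - 1) * Module.finrank ℝ W := by
    have h := L.finrank_range_add_finrank_ker
    have hE : Module.finrank ℝ (PiLp 2 fun _ : κ => W) =
        Fintype.card κ * Module.finrank ℝ W := by
      rw [(WithLp.linearEquiv 2 ℝ (κ → W)).finrank_eq]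
      simp [Module.finrank_pi_fintype]
    rw [LinearMap.range_eq_top.2 hLsurj, finrank_top, hE] at h
    rw [Nat.sub_mul]
    omega
  let p (i : ι) (k : κ) : PiLp 2 (fun _ : κ => W) :=
    WithLp.toLp 2 fun l => (if k = l then x i else 0) - r⁻¹ • x i
  have hp (i k) : p i k ∈ LinearMap.ker L := by
    rw [LinearMap.mem_ker, hL]
    simp [p, ← Nat.cast_smul_eq_nsmul ℝ, smul_smul, r]
  have h₀ (i : ι) : (0 : PiLp 2 fun _ : κ => W) ∈ convexHull ℝ (Set.range (p i)) := by
    refine mem_convexHull_of_exists_fintype (fun _ => r⁻¹) (p i)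
      (fun _ => inv_nonneg.2 (Nat.cast_nonneg _)) (by simp [r]) (fun k => ⟨k, rfl⟩) ?_
    ext l
    simp [p, ← Finset.smul_sum, ← Nat.cast_smul_eq_nsmul ℝ, smul_smul, r]
  obtain ⟨f, hf⟩ := colorful_caratheodory (LinearMap.ker L) p hp (hfin ▸ hcard) h₀
  obtain ⟨w, hw₀, hw₁, hw⟩ := exists_weights_of_mem_convexHull_range hf
  refine ⟨f, w, hw₀, hw₁, r⁻¹ • ∑ i, w i • x i, fun k => ?_⟩
  have hk := congrArg (PiLp.projₗ (𝕜 := ℝ) 2 (fun _ : κ => W) k) hw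
  simp only [map_sum, map_smul, PiLp.projₗ_apply, map_zero, p, smul_sub, smul_ite, smul_zero,
    Finset.sum_sub_distrib, sub_eq_zero] at hk
  rw [Finset.sum_filter, hk, Finset.smul_sum]
  exact Finset.sum_congr rfl fun i _ => smul_comm _ _ _

/-- **Tverberg's theorem**: more than `(r - 1) * (dim V + 1)` points can be partitioned into `r`
classes whose convex hulls have a common point. -/
theorem tverberg {V ι κ : Type*} [NormedAddCommGroup V] [InnerProductSpace ℝ V]
    [FiniteDimensional ℝ V] [Fintype ι] [Fintype κ] [Nonempty κ] (x : ι → V)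
    (hcard : (Fintype.card κ - 1) * (Module.finrank ℝ V + 1) < Fintype.card ι) :
    ∃ (f : ι → κ) (q : V), ∀ k, q ∈ convexHull ℝ (x '' (f ⁻¹' {k})) := by
  classical
  have hfin : Module.finrank ℝ (WithLp 2 (V × ℝ)) = Module.finrank ℝ V + 1 := by
    rw [(WithLp.linearEquiv 2 ℝ (V × ℝ)).finrank_eq]
    simp
  obtain ⟨f, w, hw₀, hw₁, c, hc⟩ := exists_coloring_sum_eq (κ := κ)
    (fun i => WithLp.toLp 2 (x i, (1 : ℝ))) (by rwa [hfin])
  have hc₁ (k : κ) : ∑ i with f i = k, w i • x i = c.fst := by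
    have := congrArg (LinearMap.fst ℝ V ℝ ∘ₗ (WithLp.linearEquiv 2 ℝ (V × ℝ)).toLinearMap) (hc k)
    rw [map_sum] at this
    simpa using this
  have hc₂ (k : κ) : ∑ i with f i = k, w i = c.snd := by
    have := congrArg (LinearMap.snd ℝ V ℝ ∘ₗ (WithLp.linearEquiv 2 ℝ (V × ℝ)).toLinearMap) (hc k)
    rw [map_sum] at this
    simpa using this
  have hcpos : 0 < c.snd := by
    have := Finset.sum_fiberwise Finset.univ f w
    simp only [hc₂, hw₁, Finset.sum_const, nsmul_eq_mul] at this
    by_contra h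
    have := mul_nonneg (Nat.cast_nonneg (α := ℝ) (Finset.univ (α := κ)).card)
      (neg_nonneg.2 (not_lt.1 h))
    linarith
  refine ⟨f, c.snd⁻¹ • c.fst, fun k => ?_⟩
  have := Finset.centerMass_mem_convexHull (R := ℝ) (s := x '' (f ⁻¹' {k}))
    (Finset.univ.filter fun i => f i = k) (w := w) (fun i _ => hw₀ i) (by rwa [hc₂]) (z := x)
    (fun i hi => ⟨i, by simpa using hi, rfl⟩)
  rwa [Finset.centerMass, hc₁, hc₂] at this

/-- **Carathéodory's theorem** with the bound on the number of points. -/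
theorem exists_finset_card_le_finrank_succ_mem_convexHull {V : Type*} [AddCommGroup V]
    [Module ℝ V] [FiniteDimensional ℝ V] {s : Set V} {q : V} (hq : q ∈ convexHull ℝ s) :
    ∃ t : Finset V, (t : Set V) ⊆ s ∧ t.card ≤ Module.finrank ℝ V + 1 ∧
      q ∈ convexHull ℝ (t : Set V) := by
  rw [convexHull_eq_union] at hq
  simp only [Set.mem_iUnion] at hq
  obtain ⟨t, hts, hind, hq⟩ := hq
  refine ⟨t, hts, ?_, hq⟩
  simpa using hind.card_le_finrank_succ.trans
    (Nat.add_le_add_right (Submodule.finrank_le _) 1)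

/-- **Tverberg approximation by repeated projection, odd dimension.** For `d ≥ 3` odd and
any set `P` of `n` points in `ℝ^d`, there are a point `q` and `⌊n / (2·3^((d-1)/2))⌋`
pairwise disjoint subsets of `P`, each of at most `d + 1` points, whose convex hulls all
contain `q`. -/
theorem tverberg_approx_odd_dim (d n : ℕ) (hd : 3 ≤ d) (hodd : Odd d)
    (P : Finset (EuclideanSpace ℝ (Fin d))) (hP : P.card = n) :
    ∃ (q : EuclideanSpace ℝ (Fin d))
      (Q : Fin (n / (2 * 3 ^ ((d - 1) / 2))) → Finset (EuclideanSpace ℝ (Fin d))),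
      (∀ i, Q i ⊆ P) ∧
      (∀ i, (Q i).card ≤ d + 1) ∧
      (∀ i j, i ≠ j → Disjoint (Q i) (Q j)) ∧
      ∀ i, q ∈ convexHull ℝ (Q i : Set (EuclideanSpace ℝ (Fin d))) := by
  obtain ⟨k, rfl⟩ := hodd
  have hk : 2 * k + 1 + 1 ≤ 2 * 3 ^ k := by
    have : k < 3 ^ k := Nat.lt_pow_self (by norm_num)
    omega
  rw [show (2 * k + 1 - 1) / 2 = k by omega]
  set r := n / (2 * 3 ^ k) with hr
  have hrn : r * (2 * 3 ^ k) ≤ n := Nat.div_mul_le_self _ _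
  clear_value r
  rcases Nat.eq_zero_or_pos r with rfl | hrpos
  · exact ⟨0, fun _ => ∅, by simp⟩
  have : NeZero r := ⟨hrpos.ne'⟩
  have hcard : (Fintype.card (Fin r) - 1) *
      (Module.finrank ℝ (EuclideanSpace ℝ (Fin (2 * k + 1))) + 1) < Fintype.card P := by
    simp only [Fintype.card_fin, finrank_euclideanSpace, Fintype.card_coe, hP]
    calc (r - 1) * (2 * k + 1 + 1) < r * (2 * k + 1 + 1) := by gcongr; omega
      _ ≤ r * (2 * 3 ^ k) := by gcongr
      _ ≤ n := hrn
  obtain ⟨f, q, hq⟩ := tverberg (fun i : P => (i : EuclideanSpace ℝ (Fin (2 * k + 1)))) hcard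
  choose Q hQsub hQcard hqQ using fun i =>
    exists_finset_card_le_finrank_succ_mem_convexHull (hq i)
  have hQ (i : Fin r) (y) (hy : y ∈ Q i) : ∃ h : y ∈ P, f ⟨y, h⟩ = i := by
    obtain ⟨⟨y, h⟩, hi, rfl⟩ := hQsub i hy
    exact ⟨h, hi⟩
  refine ⟨q, Q, fun i y hy => (hQ i y hy).1, fun i => by simpa using hQcard i,
    fun i j hij => Finset.disjoint_left.2 fun y hyi hyj => hij ?_, hqQ⟩
  obtain ⟨_, rfl⟩ := hQ i y hyi
  exact (hQ j y hyj).2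
end
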